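/- arXiv:2411.12323 — 2 statements merged into one kernel-verified Lean document; each statement's English description precedes it below -/
import Mathlib

section
/- In the setting of the deterministic mirror descent scheme (m ≥ ‖y*‖₁, S < ∞, positive steps γ_n, y⁰ ∈ (0,∞)^d with ‖y⁰‖₁ ≤ m, y^{k+1} = P^m_{y^k}(γ_{k+1} κ(y^k)∇Γ_g(y^k))), the weighted average ȳ^n = (Σ_{k=1}^n γ_k y^{k−1})/(Σ_{k=1}^n γ_k) satisfies, for every n ≥ 1, Γ_g(ȳ^n) − Γ_g(y*) ≤ [ D_F(y*, y⁰) + (m/2) M*² Σ_{k=1}^n γ_k² ] / [ (min_{0≤k≤n−1} min(min_i y^k_i, 1)) Σ_{k=1}^n γ_k ], where M* = S + max_{1≤i≤d} b_i. -/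
open scoped BigOperators Classical
open Set Filter

noncomputable section

/-- Bregman divergence of the negative entropy (Kullback–Leibler divergence). -/
def DF (d : ℕ) (w y : Fin d → ℝ) : ℝ :=
  ∑ i, (w i * Real.log (w i / y i) - w i + y i)

/-- The entropic proximal mapping `P^m_y(v)`. -/
def proxMap (d : ℕ) (m : ℝ) (y v : Fin d → ℝ) : Fin d → ℝ :=
  if (∑ i, y i * Real.exp (-v i)) ≤ m then fun i => y i * Real.exp (-v i)
  else fun i => (m / ∑ j, y j * Real.exp (-v j)) * (y i * Real.exp (-v i))

/-- The taming factor `κ(y) = min (min_i y_i) 1`. -/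
def kappa (d : ℕ) (y : Fin d → ℝ) : ℝ := min (⨅ i, y i) 1

theorem ConvexOn.add_fderiv_sub_le {E : Type*} [NormedAddCommGroup E] [NormedSpace ℝ E]
    {s : Set E} {f : E → ℝ} {f' : E →L[ℝ] ℝ} {x y : E} (hf : ConvexOn ℝ s f) (hx : x ∈ s)
    (hy : y ∈ s) (hf' : HasFDerivAt f f' x) : f x + f' (y - x) ≤ f y := by
  have hconv := hf.comp_affineMap (AffineMap.lineMap x y : ℝ →ᵃ[ℝ] E)
  have hd : HasDerivAt (f ∘ (AffineMap.lineMap x y : ℝ →ᵃ[ℝ] E)) (f' (y - x)) 0 := by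
    refine HasFDerivAt.comp_hasDerivAt (0 : ℝ) ?_ AffineMap.hasDerivAt_lineMap
    simpa using hf'
  have h := hconv.le_slope_of_hasDerivAt (x := 0) (y := 1) (by simpa using hx)
    (by simpa using hy) one_pos hd
  simp only [slope_def_field, Function.comp_apply, AffineMap.lineMap_apply_one,
    AffineMap.lineMap_apply_zero, sub_zero, div_one] at h
  linarith

theorem three_mul_sq_div_le_mul_log {t : ℝ} (ht : 0 < t) :
    3 * (t - 1) ^ 2 / (2 * (t + 2)) ≤ t * Real.log t - t + 1 := by
  let f : ℝ → ℝ := fun t => Real.log t - 1 + t⁻¹ - 3 * (t - 1) ^ 2 / (2 * t * (t + 2))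
  have hd : ∀ x : ℝ, 0 < x → HasDerivAt f ((x - 1) ^ 3 / (x ^ 2 * (x + 2) ^ 2)) x := by
    intro x hx
    have h1 := ((Real.hasDerivAt_log hx.ne').sub_const 1).add (hasDerivAt_inv hx.ne')
    have h2 := (((hasDerivAt_id x).sub_const 1).pow 2).const_mul 3
    have h3 := ((hasDerivAt_id x).const_mul 2).mul ((hasDerivAt_id x).add_const 2)
    have h4 := h1.sub (h2.div h3 (by simp; constructor <;> positivity))
    refine h4.congr_deriv ?_
    simp
    field_simp
    ring
  have hmin : IsMinOn f (Ioi 0) 1 := by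
    refine isMinOn_Ioi_of_deriv (hd 1 one_pos).continuousAt
      (fun x hx => (hd x hx.1).differentiableAt.differentiableWithinAt)
      (fun x hx => (hd x (one_pos.trans hx)).differentiableAt.differentiableWithinAt) ?_ ?_
    · intro x hx
      rw [(hd x hx.1).deriv]
      exact div_nonpos_of_nonpos_of_nonneg
        (Odd.pow_nonpos (by decide) (by linarith [hx.2])) (by positivity)
    · intro x hx
      have hx' : (1 : ℝ) < x := hx
      rw [(hd x (one_pos.trans hx)).deriv]
      exact div_nonneg (pow_nonneg (by linarith) _) (by positivity)
  have h := hmin (mem_Ioi.2 ht)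
  have h0 : 0 ≤ f t := by simpa [f] using h
  have h2 : t * Real.log t - t + 1 - 3 * (t - 1) ^ 2 / (2 * (t + 2)) = t * f t := by
    simp only [f]
    field_simp
  nlinarith [mul_nonneg ht.le h0]

theorem mul_sub_le_bregman_add {v y z : ℝ} (hy : 0 < y) (hz : 0 < z) :
    v * (y - z) ≤ z * Real.log (z / y) - z + y + v ^ 2 * (z + 2 * y) / 6 := by
  have h := three_mul_sq_div_le_mul_log (div_pos hz hy)
  have h1 : 3 * (z - y) ^ 2 / (2 * (z + 2 * y)) ≤ z * Real.log (z / y) - z + y := by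
    have := mul_le_mul_of_nonneg_left h hy.le
    generalize Real.log (z / y) = l at this ⊢
    convert! this using 1 <;> field_simp
  refine le_trans ?_ (add_le_add_left h1 _)
  have h3 : 3 * (z - y) ^ 2 / (2 * (z + 2 * y)) + v ^ 2 * (z + 2 * y) / 6 - v * (y - z)
      = (3 * (z - y) + v * (z + 2 * y)) ^ 2 / (6 * (z + 2 * y)) := by
    field_simp
    ring
  have : 0 ≤ (3 * (z - y) + v * (z + 2 * y)) ^ 2 / (6 * (z + 2 * y)) := by positivity
  linarith

theorem DF_nonneg {d : ℕ} {w y : Fin d → ℝ} (hw : ∀ i, 0 < w i) (hy : ∀ i, 0 < y i) :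
    0 ≤ DF d w y :=
  Finset.sum_nonneg fun i _ => by simpa using mul_sub_le_bregman_add (v := 0) (hy i) (hw i)

theorem sum_mul_sub_le_of_prox {d : ℕ} {m V c : ℝ} {w y z v : Fin d → ℝ} (hw : ∀ i, 0 < w i)
    (hy : ∀ i, 0 < y i) (hwm : ∑ i, w i ≤ m) (hym : ∑ i, y i ≤ m) (hzm : ∑ i, z i ≤ m)
    (hv : ∀ i, |v i| ≤ V) (hc : 0 ≤ c) (hcz : c * (m - ∑ i, z i) = 0)
    (hz : ∀ i, z i = y i * Real.exp (-v i - c)) :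
    ∑ i, v i * (y i - w i) ≤ DF d w y - DF d w z + m / 2 * V ^ 2 := by
  have hzpos : ∀ i, 0 < z i := fun i => by rw [hz]; exact mul_pos (hy i) (Real.exp_pos _)
  have hlog : ∀ i, Real.log (z i) = Real.log (y i) - v i - c := fun i => by
    rw [hz, Real.log_mul (hy i).ne' (Real.exp_pos _).ne', Real.log_exp]; ring
  have hi : ∀ i, v i * (y i - w i) ≤ (w i * Real.log (w i / y i) - w i + y i)
      - (w i * Real.log (w i / z i) - w i + z i) + c * w i - c * z i
      + (V ^ 2 / 6) * z i + (V ^ 2 / 3) * y i := by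
    intro i
    have h := mul_sub_le_bregman_add (v := v i) (hy i) (hzpos i)
    rw [Real.log_div (hzpos i).ne' (hy i).ne', hlog] at h
    rw [Real.log_div (hw i).ne' (hy i).ne', Real.log_div (hw i).ne' (hzpos i).ne', hlog]
    have hV : v i ^ 2 ≤ V ^ 2 := sq_le_sq' (abs_le.1 (hv i)).1 (abs_le.1 (hv i)).2
    have := mul_le_mul_of_nonneg_right hV (by linarith [hy i, hzpos i] : 0 ≤ z i + 2 * y i)
    linarith
  have hsum := Finset.sum_le_sum fun i (_ : i ∈ Finset.univ) => hi i
  simp only [Finset.sum_add_distrib, Finset.sum_sub_distrib, ← Finset.mul_sum] at hsum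
  simp only [DF, Finset.sum_add_distrib, Finset.sum_sub_distrib]
  have h1 := mul_le_mul_of_nonneg_left hwm hc
  have h2 := mul_le_mul_of_nonneg_left hzm (by positivity : 0 ≤ V ^ 2 / 6)
  have h3 := mul_le_mul_of_nonneg_left hym (by positivity : 0 ≤ V ^ 2 / 3)
  linarith

theorem exists_proxMap_eq {d : ℕ} {m : ℝ} {y : Fin d → ℝ} (v : Fin d → ℝ) (hm : 0 < m) :
    ∃ c : ℝ, 0 ≤ c ∧ c * (m - ∑ i, proxMap d m y v i) = 0 ∧ ∑ i, proxMap d m y v i ≤ m ∧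
      ∀ i, proxMap d m y v i = y i * Real.exp (-v i - c) := by
  by_cases h : (∑ i, y i * Real.exp (-v i)) ≤ m
  · exact ⟨0, by simp [proxMap, h]⟩
  · have hlt := not_le.1 h
    have hZ := hm.trans hlt
    have hs : ∑ i, proxMap d m y v i = m := by
      simp only [proxMap, h, if_false, ← Finset.mul_sum]
      exact div_mul_cancel₀ _ hZ.ne'
    refine ⟨Real.log ((∑ i, y i * Real.exp (-v i)) / m),
      Real.log_nonneg ((one_le_div hm).2 hlt.le), by simp [hs], hs.le, fun i => ?_⟩
    rw [Real.exp_sub, Real.exp_log (div_pos hZ hm), div_div_eq_mul_div]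
    simp only [proxMap, h, if_false]
    ring

theorem kappa_pos {d : ℕ} {y : Fin d → ℝ} (hd : 1 ≤ d) (hy : ∀ i, 0 < y i) : 0 < kappa d y := by
  have : Nonempty (Fin d) := ⟨⟨0, hd⟩⟩
  obtain ⟨i, hi⟩ := exists_eq_ciInf_of_finite (f := y)
  exact lt_min (hi ▸ hy i) one_pos

theorem kappa_le_one {d : ℕ} (y : Fin d → ℝ) : kappa d y ≤ 1 := min_le_right _ _

theorem kappa_le {d : ℕ} (y : Fin d → ℝ) (i : Fin d) : kappa d y ≤ y i :=
  (min_le_left _ _).trans (ciInf_le (finite_range y).bddBelow i)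

theorem pos_of_homogeneous {d : ℕ} {r : (Fin d → ℝ) → ℝ} (hd : 1 ≤ d)
    (hr_hom : ∀ c : ℝ, 0 ≤ c → ∀ y : Fin d → ℝ, (∀ i, 0 ≤ y i) → r (c • y) = c * r y)
    (hr_pos : ∀ u : Fin d → ℝ, (∀ i, 0 ≤ u i) → ∑ i, u i = 1 → 0 < r u)
    {y : Fin d → ℝ} (hy : ∀ i, 0 < y i) : 0 < r y := by
  have : Nonempty (Fin d) := ⟨⟨0, hd⟩⟩
  have hs : 0 < ∑ i, y i := Finset.sum_pos (fun i _ => hy i) Finset.univ_nonempty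
  have hu : ∀ i, 0 ≤ ((∑ i, y i)⁻¹ • y) i := fun i => mul_nonneg (inv_pos.2 hs).le (hy i).le
  have h := hr_hom (∑ i, y i) hs.le _ hu
  rw [smul_inv_smul₀ hs.ne'] at h
  rw [h]
  refine mul_pos hs (hr_pos _ hu ?_)
  simp [← Finset.mul_sum, hs.ne']

theorem convex_orthant (d : ℕ) : Convex ℝ {y : Fin d → ℝ | ∀ i, 0 < y i} :=
  fun _ hx _ hy _ _ hs ht hst i => convex_Ioi (0 : ℝ) (hx i) (hy i) hs ht hst

theorem convexOn_riskBudgeting {d : ℕ} {b : Fin d → ℝ} {r : (Fin d → ℝ) → ℝ} {g : ℝ → ℝ}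
    (hb : ∀ i, 0 < b i)
    (hr_hom : ∀ c : ℝ, 0 ≤ c → ∀ y : Fin d → ℝ, (∀ i, 0 ≤ y i) → r (c • y) = c * r y)
    (hr_sub : ∀ y y' : Fin d → ℝ, (∀ i, 0 ≤ y i) → (∀ i, 0 ≤ y' i) →
      r (y + y') ≤ r y + r y')
    (hr_pos : ∀ y : Fin d → ℝ, (∀ i, 0 < y i) → 0 < r y)
    (hg_conv : ConvexOn ℝ (Ici (0 : ℝ)) g) (hg_mono : MonotoneOn g (Ici (0 : ℝ))) :
    ConvexOn ℝ {y : Fin d → ℝ | ∀ i, 0 < y i}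
      (fun y => g (r y) - ∑ i, b i * Real.log (y i)) := by
  refine ⟨convex_orthant d, fun x hx y hy s t hs ht hst => ?_⟩
  have hx0 := fun i => (hx i).le
  have hy0 := fun i => (hy i).le
  have hr : r (s • x + t • y) ≤ s * r x + t * r y := by
    rw [← hr_hom s hs x hx0, ← hr_hom t ht y hy0]
    exact hr_sub _ _ (fun i => mul_nonneg hs (hx0 i)) (fun i => mul_nonneg ht (hy0 i))
  have hrx := (hr_pos x hx).le
  have hry := (hr_pos y hy).le
  have hg1 := hg_mono (hr_pos _ (convex_orthant d hx hy hs ht hst)).le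
    (by simp only [mem_Ici]; positivity) hr
  have hg2 := hg_conv.2 hrx hry hs ht hst
  have hl : ∑ i, (s * (b i * Real.log (x i)) + t * (b i * Real.log (y i)))
      ≤ ∑ i, b i * Real.log ((s • x + t • y) i) := by
    refine Finset.sum_le_sum fun i _ => ?_
    have := mul_le_mul_of_nonneg_left
      (strictConcaveOn_log_Ioi.concaveOn.2 (hx i) (hy i) hs ht hst) (hb i).le
    simp only [smul_eq_mul, Pi.add_apply, Pi.smul_apply] at this ⊢
    linarith
  rw [Finset.sum_add_distrib, ← Finset.mul_sum, ← Finset.mul_sum] at hl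
  simp only [smul_eq_mul] at hg2 ⊢
  linarith

theorem hasFDerivAt_riskBudgeting {d : ℕ} {b p : Fin d → ℝ} {r : (Fin d → ℝ) → ℝ} {g : ℝ → ℝ}
    {q : ℝ} {y : Fin d → ℝ} (hy : ∀ i, 0 < y i)
    (hr : HasFDerivAt r (∑ i, p i • (ContinuousLinearMap.proj i : (Fin d → ℝ) →L[ℝ] ℝ)) y)
    (hg : HasDerivAt g q (r y)) :
    HasFDerivAt (fun y => g (r y) - ∑ i, b i * Real.log (y i))
      (∑ i, (q * p i - b i / y i) • (ContinuousLinearMap.proj i : (Fin d → ℝ) →L[ℝ] ℝ)) y := by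
  have h1 := hg.comp_hasFDerivAt y hr
  have h2 := HasFDerivAt.fun_sum fun i (_ : i ∈ Finset.univ) =>
    ((ContinuousLinearMap.proj i : (Fin d → ℝ) →L[ℝ] ℝ).hasFDerivAt.log (hy i).ne').const_mul (b i)
  refine (h1.sub h2).congr_fderiv ?_
  ext w
  simp [Finset.mul_sum, sub_mul, Finset.sum_sub_distrib, div_eq_mul_inv, mul_assoc]

theorem abs_tamed_gradient_le {d : ℕ} {b p y : Fin d → ℝ} {q S : ℝ} (hd : 1 ≤ d)
    (hb : ∀ i, 0 < b i) (hy : ∀ i, 0 < y i) (hq : 0 ≤ q) (hS : q * ⨆ i, |p i| ≤ S) (i : Fin d) :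
    |kappa d y * (q * p i - b i / y i)| ≤ S + ⨆ i, b i := by
  have hk := kappa_pos hd hy
  have hp : q * |p i| ≤ S := (mul_le_mul_of_nonneg_left
    (le_ciSup (finite_range fun i => |p i|).bddAbove i) hq).trans hS
  have hbi : b i ≤ ⨆ i, b i := le_ciSup (finite_range b).bddAbove i
  have hkb : kappa d y * (b i / y i) ≤ b i := by
    rw [← mul_div_assoc, div_le_iff₀ (hy i), mul_comm]
    exact mul_le_mul_of_nonneg_left (kappa_le y i) (hb i).le
  have hkb0 : 0 ≤ kappa d y * (b i / y i) := mul_nonneg hk.le (div_pos (hb i) (hy i)).le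
  have hkp : kappa d y * (q * |p i|) ≤ q * |p i| :=
    mul_le_of_le_one_left (by positivity) (kappa_le_one y)
  have : |kappa d y * (q * p i)| = kappa d y * (q * |p i|) := by
    rw [abs_mul, abs_mul, abs_of_pos hk, abs_of_nonneg hq]
  rw [mul_sub]
  refine (abs_sub _ _).trans ?_
  rw [this, abs_of_nonneg hkb0]
  linarith

/-- non-asymptotic rate for the averaged deterministic mirror descent.
With `M* = S + max_i b_i`, the weighted averages `ȳ^n = (∑_{k=1}^n γ_k y^{k-1}) / (∑_{k=1}^n γ_k)`
satisfy
`Γ_g(ȳ^n) - Γ_g(y*) ≤ (D_F(y*, y⁰) + (m/2) M*² ∑_{k=1}^n γ_k²) /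
  ((min_{0 ≤ k ≤ n-1} κ(y^k)) ∑_{k=1}^n γ_k)`. -/
theorem DMD_average_rate
    (d : ℕ) (hd : 1 ≤ d)
    (b : Fin d → ℝ) (hb : ∀ i, 0 < b i) (hbsum : ∑ i, b i = 1)
    (r : (Fin d → ℝ) → ℝ) (rGrad : (Fin d → ℝ) → Fin d → ℝ)
    (g : ℝ → ℝ) (gDeriv : ℝ → ℝ)
    (hr_cont : ContinuousOn r {y : Fin d → ℝ | ∀ i, 0 ≤ y i})
    (hr_diff : ∀ y : Fin d → ℝ, (∀ i, 0 < y i) →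
      HasFDerivAt r (∑ i, rGrad y i • (ContinuousLinearMap.proj i : (Fin d → ℝ) →L[ℝ] ℝ)) y)
    (hrGrad_cont : ContinuousOn rGrad {y : Fin d → ℝ | ∀ i, 0 < y i})
    (hr_hom : ∀ c : ℝ, 0 ≤ c → ∀ y : Fin d → ℝ, (∀ i, 0 ≤ y i) → r (c • y) = c * r y)
    (hr_sub : ∀ y y' : Fin d → ℝ, (∀ i, 0 ≤ y i) → (∀ i, 0 ≤ y' i) →
      r (y + y') ≤ r y + r y')
    (hr_pos : ∀ u : Fin d → ℝ, (∀ i, 0 ≤ u i) → ∑ i, u i = 1 → 0 < r u)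
    (hg_diff : ∀ x : ℝ, 0 ≤ x → HasDerivAt g (gDeriv x) x)
    (hgDeriv_cont : ContinuousOn gDeriv (Ici (0 : ℝ)))
    (hg_conv : ConvexOn ℝ (Ici (0 : ℝ)) g)
    (hg_mono : StrictMonoOn g (Ici (0 : ℝ)))
    -- the unique minimizer `y*` of `Γ_g`, with vanishing gradient
    (ystar : Fin d → ℝ) (hystar_pos : ∀ i, 0 < ystar i)
    (hystar_min : IsMinOn (fun y => g (r y) - ∑ i, b i * Real.log (y i))
      {y : Fin d → ℝ | ∀ i, 0 < y i} ystar)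
    (hystar_unique : ∀ y : Fin d → ℝ, (∀ i, 0 < y i) →
      IsMinOn (fun y => g (r y) - ∑ i, b i * Real.log (y i))
        {y : Fin d → ℝ | ∀ i, 0 < y i} y → y = ystar)
    (hystar_grad : ∀ i, gDeriv (r ystar) * rGrad ystar i - b i / ystar i = 0)
    -- the radius `m ≥ ‖y*‖₁` and the constant `S` (finite)
    (m : ℝ) (hm : (∑ i, |ystar i|) ≤ m)
    (A : Set ℝ)
    (hA : A = {t : ℝ | ∃ y : Fin d → ℝ, (∀ i, 0 < y i) ∧ (∑ i, |y i|) ≤ m ∧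
      t = gDeriv (r y) * ⨆ i, |rGrad y i|})
    (hAbdd : BddAbove A)
    -- the step sequence
    (γ : ℕ → ℝ) (hγpos : ∀ n, 0 < γ (n + 1))
    -- the DMD iterates
    (y0 : Fin d → ℝ) (hy0pos : ∀ i, 0 < y0 i) (hy0m : (∑ i, |y0 i|) ≤ m)
    (yseq : ℕ → Fin d → ℝ) (hinit : yseq 0 = y0)
    (hrec : ∀ k, yseq (k + 1) = proxMap d m (yseq k)
      (fun i => γ (k + 1) * (kappa d (yseq k) *
        (gDeriv (r (yseq k)) * rGrad (yseq k) i - b i / yseq k i)))) :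
    ∀ n : ℕ, ∀ hn : 1 ≤ n,
      (fun y => g (r y) - ∑ i, b i * Real.log (y i))
          ((∑ k ∈ Finset.range n, γ (k + 1))⁻¹ • ∑ k ∈ Finset.range n, γ (k + 1) • yseq k) -
        (fun y => g (r y) - ∑ i, b i * Real.log (y i)) ystar ≤
      (DF d ystar y0 + (m / 2) * (sSup A + ⨆ i, b i) ^ 2 * ∑ k ∈ Finset.range n, γ (k + 1) ^ 2) /
        (((Finset.range n).inf' (Finset.nonempty_range_iff.mpr (by omega))
            (fun k => kappa d (yseq k))) * ∑ k ∈ Finset.range n, γ (k + 1)) := by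
  have : Nonempty (Fin d) := ⟨⟨0, hd⟩⟩
  have hr_pos' : ∀ y : Fin d → ℝ, (∀ i, 0 < y i) → 0 < r y :=
    fun y hy => pos_of_homogeneous hd hr_hom hr_pos hy
  have hconv := convexOn_riskBudgeting hb hr_hom hr_sub hr_pos' hg_conv hg_mono.monotoneOn
  have hgrad : ∀ y : Fin d → ℝ, ∀ hy : ∀ i, 0 < y i, _ :=
    fun y hy => hasFDerivAt_riskBudgeting (b := b) hy (hr_diff y hy) (hg_diff _ (hr_pos' y hy).le)
  set Γ : (Fin d → ℝ) → ℝ := fun y => g (r y) - ∑ i, b i * Real.log (y i)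
  have hgDeriv_nonneg : ∀ x : ℝ, 0 ≤ x → 0 ≤ gDeriv x := fun x hx => by
    rw [← (hg_diff x hx).hasDerivWithinAt.derivWithin (uniqueDiffOn_Ici 0 x hx)]
    exact hg_mono.monotoneOn.derivWithin_nonneg
  have hwm : ∑ i, ystar i ≤ m := by simpa only [abs_of_pos (hystar_pos _)] using hm
  have hm_pos : 0 < m :=
    (Finset.sum_pos (fun i _ => hystar_pos i) Finset.univ_nonempty).trans_le hwm
  have hiter : ∀ k, (∀ i, 0 < yseq k i) ∧ ∑ i, yseq k i ≤ m := by
    intro k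
    induction k with
    | zero =>
      rw [hinit]
      exact ⟨hy0pos, by simpa only [abs_of_pos (hy0pos _)] using hy0m⟩
    | succ k ih =>
      rw [hrec k]
      obtain ⟨c, -, -, hle, heq⟩ := exists_proxMap_eq (y := yseq k) (fun i => γ (k + 1) *
        (kappa d (yseq k) * (gDeriv (r (yseq k)) * rGrad (yseq k) i - b i / yseq k i))) hm_pos
      exact ⟨fun i => by rw [heq]; exact mul_pos (ih.1 i) (Real.exp_pos _), hle⟩
  have hgap : ∀ k, 0 ≤ Γ (yseq k) - Γ ystar := fun k => sub_nonneg.2 (hystar_min (hiter k).1)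
  have hkpos : ∀ k, 0 < kappa d (yseq k) := fun k => kappa_pos hd (hiter k).1
  set M := sSup A + ⨆ i, b i
  have hstep : ∀ k, γ (k + 1) * (kappa d (yseq k) * (Γ (yseq k) - Γ ystar)) ≤
      DF d ystar (yseq k) - DF d ystar (yseq (k + 1)) + m / 2 * (γ (k + 1) * M) ^ 2 := by
    intro k
    obtain ⟨hy, hym⟩ := hiter k
    have hS : gDeriv (r (yseq k)) * ⨆ i, |rGrad (yseq k) i| ≤ sSup A := by
      refine le_csSup hAbdd ?_
      rw [hA]
      exact ⟨yseq k, hy, by simpa only [abs_of_pos (hy _)] using hym, rfl⟩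
    obtain ⟨c, hc, hcz, hle, heq⟩ := exists_proxMap_eq (y := yseq k) (fun i => γ (k + 1) *
      (kappa d (yseq k) * (gDeriv (r (yseq k)) * rGrad (yseq k) i - b i / yseq k i))) hm_pos
    rw [← hrec k] at hcz hle heq
    refine le_trans ?_ (sum_mul_sub_le_of_prox hystar_pos hy hwm hym hle (fun i => ?_) hc hcz heq)
    · have h := hconv.add_fderiv_sub_le hy hystar_pos (hgrad _ hy)
      simp only [sum_apply, smul_apply,
        ContinuousLinearMap.proj_apply, smul_eq_mul, Pi.sub_apply] at h
      simp only [mul_assoc, ← Finset.mul_sum]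
      refine mul_le_mul_of_nonneg_left (mul_le_mul_of_nonneg_left ?_ (hkpos k).le) (hγpos k).le
      rw [← sub_nonneg] at h ⊢
      convert! h using 1
      simp only [mul_sub, Finset.sum_sub_distrib]
      ring
    · rw [abs_mul, abs_of_pos (hγpos k)]
      exact mul_le_mul_of_nonneg_left (abs_tamed_gradient_le hd hb hy
        (hgDeriv_nonneg _ (hr_pos' _ hy).le) hS i) (hγpos k).le
  intro n hn
  have hne : (Finset.range n).Nonempty := Finset.nonempty_range_iff.mpr (by omega)
  have hGpos : 0 < ∑ k ∈ Finset.range n, γ (k + 1) := Finset.sum_pos (fun k _ => hγpos k) hne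
  have hKpos : 0 < (Finset.range n).inf' hne (fun k => kappa d (yseq k)) :=
    (Finset.lt_inf'_iff hne).2 fun k _ => hkpos k
  have hsum := Finset.sum_le_sum fun k (_ : k ∈ Finset.range n) => hstep k
  rw [Finset.sum_add_distrib, Finset.sum_range_sub', ← Finset.mul_sum, hinit] at hsum
  simp only [mul_pow, ← Finset.sum_mul] at hsum
  have hDF := DF_nonneg hystar_pos (hiter n).1
  have hjensen := hconv.map_centerMass_le (t := Finset.range n) (w := fun k => γ (k + 1))
    (p := yseq) (fun k _ => (hγpos k).le) hGpos fun k _ => (hiter k).1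
  simp only [Finset.centerMass, smul_eq_mul, Function.comp_apply] at hjensen
  rw [inv_mul_eq_div, le_div_iff₀ hGpos] at hjensen
  rw [le_div_iff₀ (mul_pos hKpos hGpos)]
  set K := (Finset.range n).inf' hne (fun k => kappa d (yseq k))
  have hK : K * ∑ k ∈ Finset.range n, γ (k + 1) * (Γ (yseq k) - Γ ystar) ≤
      ∑ k ∈ Finset.range n, γ (k + 1) * (kappa d (yseq k) * (Γ (yseq k) - Γ ystar)) := by
    rw [Finset.mul_sum]
    refine Finset.sum_le_sum fun k hk => ?_
    rw [mul_left_comm]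
    exact mul_le_mul_of_nonneg_left
      (mul_le_mul_of_nonneg_right (Finset.inf'_le _ hk) (hgap k)) (hγpos k).le
  simp only [mul_sub, Finset.sum_sub_distrib, ← Finset.sum_mul] at hK hsum
  have hKj := mul_le_mul_of_nonneg_left hjensen hKpos.le
  linarith

end
end

section
/- For every m > 0 and all pairs z = (ξ, y), z' = (ξ', y') with ξ, ξ' ∈ ℝ, y ∈ ℝ_+^d, y' ∈ (0,∞)^d, ‖y‖₁ ≤ m and ‖y'‖₁ ≤ m, the divergence D_G(z, z') := (1/2)(ξ − ξ')² + D_F(y, y') satisfies D_G(z, z') ≥ (1/(4 max(m,1))) ‖z − z'‖₁², where ‖z − z'‖₁ = |ξ − ξ'| + ‖y − y'‖₁. -/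
open scoped BigOperators

theorem hasDerivAt_log_sub_pade {t : ℝ} (ht : 0 < t) :
    HasDerivAt (fun t : ℝ => Real.log t - (t - 1) * (5 * t + 1) / (2 * t * (t + 2)))
      ((t - 1) ^ 3 / (t ^ 2 * (t + 2) ^ 2)) t := by
  have hnum : HasDerivAt (fun t : ℝ => (t - 1) * (5 * t + 1))
      (1 * (5 * t + 1) + (t - 1) * (5 * 1)) t :=
    ((hasDerivAt_id' t).sub_const 1).mul (((hasDerivAt_id' t).const_mul 5).add_const 1)
  have hden : HasDerivAt (fun t : ℝ => 2 * t * (t + 2)) (2 * 1 * (t + 2) + 2 * t * 1) t :=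
    ((hasDerivAt_id' t).const_mul 2).mul ((hasDerivAt_id' t).add_const 2)
  have hne : 2 * t * (t + 2) ≠ 0 := by positivity
  refine ((Real.hasDerivAt_log ht.ne').sub (hnum.div hden hne)).congr_deriv ?_
  field_simp
  ring

/-- A rational lower bound for the logarithm, exact to third order at `1`. -/
theorem pade_le_log {t : ℝ} (ht : 0 < t) :
    (t - 1) * (5 * t + 1) / (2 * t * (t + 2)) ≤ Real.log t := by
  let f : ℝ → ℝ := fun t => Real.log t - (t - 1) * (5 * t + 1) / (2 * t * (t + 2))
  have hf {s : ℝ} (hs : 0 < s) : HasDerivAt f ((s - 1) ^ 3 / (s ^ 2 * (s + 2) ^ 2)) s :=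
    hasDerivAt_log_sub_pade hs
  have hf1 : f 1 = 0 := by simp [f]
  suffices f 1 ≤ f t by
    rw [hf1] at this
    exact sub_nonneg.mp this
  rcases le_total t 1 with h | h
  · have hanti : AntitoneOn f (Set.Icc t 1) := by
      refine antitoneOn_of_hasDerivWithinAt_nonpos (convex_Icc t 1)
        (fun s hs => (hf (ht.trans_le hs.1)).continuousAt.continuousWithinAt)
        (fun s hs => (hf (ht.trans_le (interior_subset hs).1)).hasDerivWithinAt) fun s hs => ?_
      have hs1 : s - 1 ≤ 0 := sub_nonpos.mpr (interior_subset hs).2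
      exact div_nonpos_of_nonpos_of_nonneg (Odd.pow_nonpos (by decide) hs1) (by positivity)
    exact hanti ⟨le_rfl, h⟩ ⟨h, le_rfl⟩ h
  · have hmono : MonotoneOn f (Set.Icc 1 t) := by
      refine monotoneOn_of_hasDerivWithinAt_nonneg (convex_Icc 1 t)
        (fun s hs => (hf (one_pos.trans_le hs.1)).continuousAt.continuousWithinAt)
        (fun s hs => (hf (one_pos.trans_le (interior_subset hs).1)).hasDerivWithinAt)
        fun s hs => ?_
      have hs1 : 0 ≤ s - 1 := sub_nonneg.mpr (interior_subset hs).1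
      positivity
    exact hmono ⟨le_rfl, h⟩ ⟨h, le_rfl⟩ h

theorem sq_div_le_mul_log_div {a b : ℝ} (ha : 0 ≤ a) (hb : 0 < b) :
    3 / 2 * ((a - b) ^ 2 / (a + 2 * b)) ≤ a * Real.log (a / b) - a + b := by
  rcases ha.eq_or_lt with rfl | ha
  · apply le_of_sub_nonneg
    have : 0 * Real.log (0 / b) - 0 + b - 3 / 2 * ((0 - b) ^ 2 / (0 + 2 * b)) = b / 4 := by
      field_simp
      ring
    rw [this]
    positivity
  · have h := mul_le_mul_of_nonneg_left (pade_le_log (div_pos ha hb)) ha.le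
    have e : a * ((a / b - 1) * (5 * (a / b) + 1) / (2 * (a / b) * (a / b + 2))) =
        3 / 2 * ((a - b) ^ 2 / (a + 2 * b)) + a - b := by
      field_simp
      ring
    linarith

/-- Strong convexity of the negative entropy on the `ℓ¹`-ball of radius `m`
(a generalized Pinsker inequality). -/
theorem sq_sum_abs_sub_le_mul_sum_mul_log_div {ι : Type*} [Fintype ι] {m : ℝ} {y y' : ι → ℝ}
    (hy : ∀ i, 0 ≤ y i) (hy' : ∀ i, 0 < y' i) (hym : ∑ i, y i ≤ m) (hy'm : ∑ i, y' i ≤ m) :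
    (∑ i, |y i - y' i|) ^ 2 ≤ 2 * m * ∑ i, (y i * Real.log (y i / y' i) - y i + y' i) := by
  have hw (i : ι) : 0 < y i + 2 * y' i := by linarith [hy i, hy' i]
  have hcs : (∑ i, |y i - y' i|) ^ 2 ≤
      (∑ i, (y i + 2 * y' i)) * ∑ i, (y i - y' i) ^ 2 / (y i + 2 * y' i) := by
    refine Finset.sum_sq_le_sum_mul_sum_of_sq_le_mul _ (fun i _ => (hw i).le)
      (fun i _ => div_nonneg (sq_nonneg _) (hw i).le) fun i _ => ?_
    rw [sq_abs, mul_div_cancel₀ _ (hw i).ne']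
  have hmass : ∑ i, (y i + 2 * y' i) ≤ 3 * m := by
    rw [Finset.sum_add_distrib, ← Finset.mul_sum]
    linarith
  have hm : 0 ≤ m := (Finset.sum_nonneg fun i _ => hy i).trans hym
  have hsum : 3 / 2 * ∑ i, (y i - y' i) ^ 2 / (y i + 2 * y' i) ≤
      ∑ i, (y i * Real.log (y i / y' i) - y i + y' i) := by
    rw [Finset.mul_sum]
    exact Finset.sum_le_sum fun i _ => sq_div_le_mul_log_div (hy i) (hy' i)
  calc (∑ i, |y i - y' i|) ^ 2
      ≤ 3 * m * ∑ i, (y i - y' i) ^ 2 / (y i + 2 * y' i) :=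
        hcs.trans <| mul_le_mul_of_nonneg_right hmass <|
          Finset.sum_nonneg fun i _ => div_nonneg (sq_nonneg _) (hw i).le
    _ = 2 * m * (3 / 2 * ∑ i, (y i - y' i) ^ 2 / (y i + 2 * y' i)) := by ring
    _ ≤ _ := by gcongr

/-- The Bregman divergence `D_G(z,z') = (1/2)(ξ-ξ')² + D_F(y,y')` of
`G(ξ,y) = ξ²/2 + ∑ i, y i log (y i)` satisfies, on `ℝ × (ℓ¹-ball of radius m)`,
`D_G(z,z') ≥ ‖z - z'‖₁² / (4 max(m,1))` with `‖z-z'‖₁ = |ξ-ξ'| + ‖y-y'‖₁`. -/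
theorem DG_strong_convexity
    (d : ℕ) (hd : 1 ≤ d) (m : ℝ) (hm : 0 < m)
    (ξ ξ' : ℝ) (y y' : Fin d → ℝ)
    (hy : ∀ i, 0 ≤ y i) (hy' : ∀ i, 0 < y' i)
    (hym : (∑ i, |y i|) ≤ m) (hy'm : (∑ i, |y' i|) ≤ m) :
    (1 / (4 * max m 1)) * (|ξ - ξ'| + ∑ i, |y i - y' i|) ^ 2 ≤
      (1 / 2) * (ξ - ξ') ^ 2 + ∑ i, (y i * Real.log (y i / y' i) - y i + y' i) := by
  simp only [abs_of_nonneg (hy _), abs_of_pos (hy' _)] at hym hy'm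
  have hD := sq_sum_abs_sub_le_mul_sum_mul_log_div hy hy' hym hy'm
  set D := ∑ i, (y i * Real.log (y i / y' i) - y i + y' i)
  set S := ∑ i, |y i - y' i|
  have hD0 : 0 ≤ D := nonneg_of_mul_nonneg_right ((sq_nonneg S).trans hD) (by positivity)
  have hM1 : 1 ≤ max m 1 := le_max_right m 1
  have hSM : S ^ 2 ≤ 2 * max m 1 * D := hD.trans (by gcongr; exact le_max_left m 1)
  have hξ : (ξ - ξ') ^ 2 ≤ max m 1 * (ξ - ξ') ^ 2 := le_mul_of_one_le_left (sq_nonneg _) hM1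
  rw [one_div_mul_eq_div, div_le_iff₀ (by positivity)]
  linarith [add_sq_le (a := |ξ - ξ'|) (b := S), sq_abs (ξ - ξ')]
end
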